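/- Let G be an abelian group and let α ↦ g_α^{(1)}, …, α ↦ g_α^{(k)} be IP-systems in G. Then for every finite coloring c : G → {1,…,r} there exist h ∈ G and a nonempty α ∈ 𝓕 such that the elements h·g_α^{(1)}, h·g_α^{(2)}, …, h·g_α^{(k)} all have the same color. -/

import Mathlib

/-- An IP-system in a commutative monoid is determined by its values on singletons. -/
lemma ip_system_eq_prod_singleton {M : Type*} [CommMonoid M] (f : Finset ℕ → M)
    (hf : ∀ α β : Finset ℕ, α.Nonempty → β.Nonempty → Disjoint α β → f (α ∪ β) = f α * f β)
    {α : Finset ℕ} (hα : α.Nonempty) : f α = ∏ x ∈ α, f {x} := by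
  induction hα using Finset.Nonempty.cons_induction with
  | singleton a => simp
  | cons a s ha hs ih =>
    rw [Finset.prod_cons, ← ih, ← hf _ _ (Finset.singleton_nonempty a) hs (by simpa using ha),
      Finset.cons_eq_insert, Finset.insert_eq]

/-- Let `G` be an abelian group and `α ↦ g i α` (`i = 1, …, k`) IP-systems in `G`
(indexed by the nonempty finite subsets of `ℕ`).  For every finite coloring
`c : G → Fin r` there exist `h ∈ G` and a nonempty `α` such that
`h * g 1 α, …, h * g k α` all have the same color. -/
theorem ip_systems_monochromatic_translate {G : Type*} [CommGroup G]
    (k : ℕ) (g : Fin k → Finset ℕ → G)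
    (hIP : ∀ i : Fin k, ∀ α β : Finset ℕ, α.Nonempty → β.Nonempty → Disjoint α β →
      g i (α ∪ β) = g i α * g i β)
    (r : ℕ) (c : G → Fin r) :
    ∃ (h : G) (α : Finset ℕ), α.Nonempty ∧
      ∀ i j : Fin k, c (h * g i α) = c (h * g j α) := by
  classical
  obtain ⟨ι, _, hHJ⟩ := Combinatorics.Line.exists_mono_in_high_dimension (Fin k) (Fin r)
  let e : ι → ℕ := fun x => Fintype.equivFin ι x
  have he : Function.Injective e := Fin.val_injective.comp (Fintype.equivFin ι).injective
  obtain ⟨l, color, hl⟩ := hHJ fun v => c (∏ x, g (v x) {e x})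
  let S : Finset ι := {x | l.idxFun x = none}
  have hS : S.Nonempty := by
    obtain ⟨x, hx⟩ := l.proper
    exact ⟨x, by simp [S, hx]⟩
  let h : G := ∏ x ∈ Sᶜ, (l.idxFun x).elim 1 fun j => g j {e x}
  have key (i : Fin k) : h * g i (S.image e) = ∏ x, g (l i x) {e x} := by
    rw [ip_system_eq_prod_singleton (g i) (hIP i) (hS.image e),
      Finset.prod_image he.injOn, ← Finset.prod_compl_mul_prod S]
    congr 1
    · refine Finset.prod_congr rfl fun x hx => ?_
      have hx' : l.idxFun x ≠ none := by simpa [S] using hx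
      obtain ⟨j, hj⟩ := Option.ne_none_iff_exists'.mp hx'
      simp [hj]
    · refine Finset.prod_congr rfl fun x hx => ?_
      have hx' : l.idxFun x = none := by simpa [S] using hx
      simp [hx']
  refine ⟨h, S.image e, hS.image e, fun i j => ?_⟩
  rw [key, key]
  exact (hl i).trans (hl j).symm
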